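/- arXiv:1906.04223 — 2 statements merged into one kernel-verified Lean document; each statement's English description precedes it below -/
import Mathlib

section
/- Let M be an m×n complex matrix and let ρ be an integer with 1 ≤ ρ < min(m,n). Then the minimum of ‖M − N‖_F over all m×n matrices N of rank at most ρ equals √(Σ_{j>ρ} σ_j(M)²), and this minimum is attained by the ρ-truncation M_ρ of M. -/
open Matrix

/-- Frobenius norm of a complex matrix. -/
noncomputable def frob {m n : ℕ} (A : Matrix (Fin m) (Fin n) ℂ) : ℝ :=
  Real.sqrt (∑ i, ∑ j, ‖A i j‖ ^ 2)

lemma eym_comb {k ρ : ℕ} (hρ : ρ < k) (s w : Fin k → ℝ) (hs : Antitone s) (hs0 : ∀ i, 0 ≤ s i)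
    (hw0 : ∀ i, 0 ≤ w i) (hw1 : ∀ i, w i ≤ 1) (hw : ∑ i, w i ≤ ρ) :
    ∑ j ∈ Finset.univ.filter (fun j : Fin k => ρ ≤ (j : ℕ)), s j ≤ ∑ i, s i * (1 - w i) := by
  set t := s ⟨ρ, hρ⟩ with ht
  have hcard : ∑ i : Fin k, (if (i : ℕ) < ρ then (1 : ℝ) else 0) = ρ := by
    rw [Fin.sum_univ_eq_sum_range (fun i => if i < ρ then (1 : ℝ) else 0) k, ← Finset.sum_filter]
    have : (Finset.range k).filter (fun i => i < ρ) = Finset.range ρ := by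
      ext i; simp; omega
    rw [this]; simp
  have key : ∑ i : Fin k, t * ((if (i : ℕ) < ρ then (1 : ℝ) else 0) - w i) ≤
      ∑ i : Fin k, (s i * (1 - w i) - if ρ ≤ (i : ℕ) then s i else 0) := by
    apply Finset.sum_le_sum
    intro i _
    by_cases h : (i : ℕ) < ρ
    · have h1 : t ≤ s i := hs (by rw [Fin.le_def]; exact h.le)
      rw [if_pos h, if_neg (by omega)]
      nlinarith [hw1 i]
    · have h1 : s i ≤ t := hs (by rw [Fin.le_def]; simp; omega)
      rw [if_neg h, if_pos (by omega)]
      nlinarith [hw0 i]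
  rw [← Finset.mul_sum, Finset.sum_sub_distrib, hcard, Finset.sum_sub_distrib] at key
  rw [Finset.sum_filter]
  have : 0 ≤ t * ((ρ : ℝ) - ∑ i, w i) := mul_nonneg (hs0 _) (by linarith)
  linarith

lemma eym_orthonormal {m k : ℕ} (U : Matrix (Fin m) (Fin k) ℂ) (hU : Uᴴ * U = 1) :
    Orthonormal ℂ (fun i : Fin k => (WithLp.toLp 2 (fun r => U r i) : EuclideanSpace ℂ (Fin m))) := by
  rw [orthonormal_iff_ite]
  intro i j
  have h := congrFun (congrFun hU i) j
  rw [Matrix.mul_apply, Matrix.one_apply] at h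
  rw [← h]
  simp [PiLp.inner_apply, mul_comm]

lemma eym_frob_sq {m n : ℕ} (A : Matrix (Fin m) (Fin n) ℂ) :
    ((∑ i, ∑ j, ‖A i j‖ ^ 2 : ℝ) : ℂ) = (A * Aᴴ).trace := by
  simp [Matrix.trace, Matrix.mul_apply, Complex.mul_conj, Complex.normSq_eq_norm_sq]

lemma eym_proj {m k ρ : ℕ} (S : Submodule ℂ (EuclideanSpace ℂ (Fin m)))
    (hS : Module.finrank ℂ S ≤ ρ)
    (u : Fin k → EuclideanSpace ℂ (Fin m)) (hu : Orthonormal ℂ u) :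
    ∑ i, ‖S.starProjection (u i)‖ ^ 2 ≤ ρ := by
  let b := stdOrthonormalBasis ℂ S
  have h1 : ∀ i, ‖S.starProjection (u i)‖ ^ 2 = ∑ j, ‖inner ℂ (u i) (b j : EuclideanSpace ℂ (Fin m))‖ ^ 2 := by
    intro i
    rw [Submodule.starProjection_apply, ← Submodule.coe_norm, ← b.sum_sq_norm_inner_right]
    apply Finset.sum_congr rfl
    intro j _
    rw [norm_inner_symm]
    simp
  simp_rw [h1]
  rw [Finset.sum_comm]
  calc _ ≤ ∑ j : Fin (Module.finrank ℂ S), (1 : ℝ) := by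
        apply Finset.sum_le_sum
        intro j _
        have := hu.sum_inner_products_le (b j : EuclideanSpace ℂ (Fin m)) (s := Finset.univ)
        have hb : ‖(b j : EuclideanSpace ℂ (Fin m))‖ = 1 := b.orthonormal.1 j
        rw [hb] at this
        simpa using this
    _ ≤ ρ := by simpa using hS

lemma eym_dist {m : ℕ} (S : Submodule ℂ (EuclideanSpace ℂ (Fin m)))
    (u x : EuclideanSpace ℂ (Fin m)) (hu : ‖u‖ = 1) (hx : x ∈ S) (s : ℝ) :
    s ^ 2 * (1 - ‖S.starProjection u‖ ^ 2) ≤ ‖(s : ℂ) • u - x‖ ^ 2 := by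
  have h1 := S.norm_sq_eq_add_norm_sq_starProjection u
  have h2 := Sᗮ.norm_starProjection_apply_le ((s : ℂ) • u - x)
  have h3 : Sᗮ.starProjection ((s : ℂ) • u - x) = (s : ℂ) • Sᗮ.starProjection u := by
    rw [map_sub, map_smul, (Submodule.starProjection_apply_eq_zero_iff Sᗮ).2 (S.le_orthogonal_orthogonal hx), sub_zero]
  rw [h3, norm_smul] at h2
  have h4 := pow_le_pow_left₀ (by positivity) h2 2
  rw [mul_pow, Complex.norm_real, Real.norm_eq_abs, sq_abs] at h4
  have : 1 - ‖S.starProjection u‖ ^ 2 = ‖Sᗮ.starProjection u‖ ^ 2 := by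
    rw [hu] at h1; linarith
  rw [this]; exact h4

lemma eym_bessel {m n k : ℕ} (A : Matrix (Fin m) (Fin n) ℂ) (V : Matrix (Fin n) (Fin k) ℂ)
    (hV : Vᴴ * V = 1) :
    ∑ r, ∑ i, ‖(A * V) r i‖ ^ 2 ≤ ∑ r, ∑ j, ‖A r j‖ ^ 2 := by
  apply Finset.sum_le_sum
  intro r _
  have := (eym_orthonormal V hV).sum_inner_products_le
    (WithLp.toLp 2 (fun j => star (A r j)) : EuclideanSpace ℂ (Fin n)) (s := Finset.univ)
  rw [EuclideanSpace.norm_sq_eq] at this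
  simp only [norm_star] at this
  refine le_trans (le_of_eq ?_) this
  apply Finset.sum_congr rfl
  intro i _
  rw [norm_inner_symm]
  simp [PiLp.inner_apply, Matrix.mul_apply, mul_comm]

/-- Eckart–Young–Mirsky theorem, Frobenius-norm version: if `M = U Σ Vᴴ` is an SVD
of the `m×n` matrix `M` (with nonincreasing nonnegative singular values `σ`) and
`1 ≤ ρ < min m n`, then the `ρ`-truncation `Mρ` has rank at most `ρ`, attains the
error `√(Σ_{j>ρ} σ_j(M)²)` (indices `j ≥ ρ` in 0-based indexing), and this error is
minimal among all matrices `N` of rank at most `ρ`. -/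
theorem eckart_young_mirsky_frobenius {m n ρ : ℕ} (hρ1 : 1 ≤ ρ) (hρ : ρ < min m n)
    (M : Matrix (Fin m) (Fin n) ℂ)
    (U : Matrix (Fin m) (Fin (min m n)) ℂ) (σ : Fin (min m n) → ℝ)
    (V : Matrix (Fin n) (Fin (min m n)) ℂ)
    (hU : Uᴴ * U = 1) (hV : Vᴴ * V = 1)
    (hσ0 : ∀ i, 0 ≤ σ i) (hσa : Antitone σ)
    (hM : M = U * Matrix.diagonal (fun i => (σ i : ℂ)) * Vᴴ)
    (Mρ : Matrix (Fin m) (Fin n) ℂ)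
    (hMρ : Mρ = U * Matrix.diagonal (fun i : Fin (min m n) => if (i : ℕ) < ρ then (σ i : ℂ) else 0) * Vᴴ) :
    Mρ.rank ≤ ρ ∧
      frob (M - Mρ) =
        Real.sqrt (∑ j ∈ Finset.univ.filter (fun j : Fin (min m n) => ρ ≤ (j : ℕ)), σ j ^ 2) ∧
      ∀ N : Matrix (Fin m) (Fin n) ℂ, N.rank ≤ ρ →
        Real.sqrt (∑ j ∈ Finset.univ.filter (fun j : Fin (min m n) => ρ ≤ (j : ℕ)), σ j ^ 2) ≤
          frob (M - N) := by
  refine ⟨?_, ?_, ?_⟩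
  · rw [hMρ]
    refine (Matrix.rank_mul_le_left _ _).trans ((Matrix.rank_mul_le_right _ _).trans ?_)
    rw [Matrix.rank_diagonal]
    let f : {i : Fin (min m n) // (if (i : ℕ) < ρ then (σ i : ℂ) else 0) ≠ 0} → Fin ρ :=
      fun i => ⟨i.1, by
        by_contra h
        exact i.2 (if_neg h)⟩
    have hf : Function.Injective f := by
      intro a b hab
      have := congrArg Fin.val hab
      exact Subtype.ext (Fin.ext this)
    simpa using Fintype.card_le_of_injective f hf
  · unfold frob
    congr 1
    have hd : M - Mρ = U * Matrix.diagonal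
        (fun i : Fin (min m n) => if ρ ≤ (i : ℕ) then (σ i : ℂ) else 0) * Vᴴ := by
      rw [hM, hMρ, ← Matrix.sub_mul, ← Matrix.mul_sub, Matrix.diagonal_sub]
      congr 3
      funext i
      by_cases h : (i : ℕ) < ρ
      · simp [h]
      · simp [h, not_lt.1 h]
    apply Complex.ofReal_injective
    rw [eym_frob_sq, hd]
    set D := Matrix.diagonal
        (fun i : Fin (min m n) => if ρ ≤ (i : ℕ) then (σ i : ℂ) else 0) with hD
    have : (U * D * Vᴴ) * (U * D * Vᴴ)ᴴ = U * (D * Dᴴ * Uᴴ) := by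
      rw [Matrix.conjTranspose_mul, Matrix.conjTranspose_mul, Matrix.conjTranspose_conjTranspose]
      calc _ = U * D * (Vᴴ * V) * Dᴴ * Uᴴ := by simp only [Matrix.mul_assoc]
        _ = _ := by rw [hV]; simp only [Matrix.mul_assoc, Matrix.mul_one]
    rw [this, Matrix.trace_mul_comm, Matrix.mul_assoc, hU, Matrix.mul_one, hD,
      Matrix.diagonal_conjTranspose, Matrix.diagonal_mul_diagonal, Matrix.trace_diagonal,
      Finset.sum_filter]
    push_cast
    apply Finset.sum_congr rfl
    intro i _
    by_cases h : ρ ≤ (i : ℕ) <;> simp [h, sq]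
  · intro N hN
    unfold frob
    apply Real.sqrt_le_sqrt
    refine le_trans ?_ (eym_bessel (M - N) V hV)
    let S : Submodule ℂ (EuclideanSpace ℂ (Fin m)) := LinearMap.range (Matrix.toEuclideanLin N)
    have hS : Module.finrank ℂ S ≤ ρ := by
      refine le_trans (le_of_eq ?_) hN
      exact (Matrix.rank_eq_finrank_range_toLin N (EuclideanSpace.basisFun (Fin m) ℂ).toBasis
        (EuclideanSpace.basisFun (Fin n) ℂ).toBasis).symm
    let u : Fin (min m n) → EuclideanSpace ℂ (Fin m) := fun i => WithLp.toLp 2 (fun r => U r i)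
    have hu : Orthonormal ℂ u := eym_orthonormal U hU
    have hc := eym_comb hρ (fun i => σ i ^ 2) (fun i => ‖S.starProjection (u i)‖ ^ 2)
      (fun i j h => pow_le_pow_left₀ (hσ0 j) (hσa h) 2) (fun i => sq_nonneg _)
      (fun i => sq_nonneg _)
      (fun i => by
        have := S.norm_starProjection_apply_le (u i)
        rw [hu.1 i] at this
        exact pow_le_one₀ (norm_nonneg _) this)
      (eym_proj S hS u hu)
    refine hc.trans ?_
    rw [Finset.sum_comm]
    apply Finset.sum_le_sum
    intro i _
    refine (eym_dist S (u i) (Matrix.toEuclideanLin N (WithLp.toLp 2 (fun j => V j i)))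
      (hu.1 i) ⟨_, rfl⟩ (σ i)).trans (le_of_eq ?_)
    rw [EuclideanSpace.norm_sq_eq]
    apply Finset.sum_congr rfl
    intro r _
    have hMV : M * V = U * Matrix.diagonal (fun i => (σ i : ℂ)) := by
      rw [hM, Matrix.mul_assoc, hV, Matrix.mul_one]
    rw [Matrix.sub_mul, hMV, Matrix.sub_apply, Matrix.mul_diagonal]
    congr 2
    simp [u, Matrix.toEuclideanLin, Matrix.mulVec, dotProduct, Matrix.mul_apply, mul_comm]
end

section
/- Let M be an m×n complex matrix of rank ρ with compact SVD M = UΣV^*, where U is m×ρ and V is n×ρ, each with orthonormal columns, and Σ is a ρ×ρ invertible diagonal matrix. Let I be a set of k ≥ ρ row indices and J a set of l ≥ ρ column indices such that the k×ρ submatrix U_{I,:} of U has rank ρ and the ρ×l submatrix (V^*)_{:,J} of V^* has rank ρ. Define C = UΣ(V^*)_{:,J}, R = U_{I,:}ΣV^*, G = U_{I,:}Σ(V^*)_{:,J}, and N = G⁺ (the Moore–Penrose pseudoinverse of G). Then M = C·N·R. -/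
open Matrix

/-- `X` is the Moore–Penrose pseudoinverse of `A` (the four Moore–Penrose conditions). -/
def IsMPInv {k r : ℕ} (A : Matrix (Fin k) (Fin r) ℂ) (X : Matrix (Fin r) (Fin k) ℂ) : Prop :=
  A * X * A = A ∧ X * A * X = X ∧ (A * X)ᴴ = A * X ∧ (X * A)ᴴ = X * A

open scoped ComplexOrder in
theorem cur_left_inv {k r : ℕ} (A : Matrix (Fin k) (Fin r) ℂ) (h : A.rank = r) :
    ∃ B : Matrix (Fin r) (Fin k) ℂ, B * A = 1 := by
  have h1 : (Aᴴ * A).rank = Fintype.card (Fin r) := by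
    rw [Matrix.rank_conjTranspose_mul_self, h, Fintype.card_fin]
  have h2 : IsUnit (Aᴴ * A) := by
    rw [← Matrix.linearIndependent_rows_iff_isUnit, linearIndependent_iff_card_eq_finrank_span,
      Set.finrank, ← Matrix.rank_eq_finrank_span_row, h1]
  refine ⟨(Aᴴ * A)⁻¹ * Aᴴ, ?_⟩
  rw [Matrix.mul_assoc]
  exact Matrix.nonsing_inv_mul _ ((Matrix.isUnit_iff_isUnit_det _).1 h2)

open scoped ComplexOrder in
theorem cur_rank {k r : ℕ} (A : Matrix (Fin k) (Fin r) ℂ) : Aᴴ.rank = A.rank :=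
  Matrix.rank_conjTranspose A

/-- Transition from compact SVD to CUR decomposition: let `M = U Σ Vᴴ` be a compact SVD
of the rank-`ρ` matrix `M` (`U` of size `m×ρ`, `V` of size `n×ρ`, each with orthonormal
columns, and `Σ = diagonal d` a `ρ×ρ` invertible diagonal matrix). Let `ι` select `k ≥ ρ`
rows and `κ` select `l ≥ ρ` columns such that `U_{I,:}` has rank `ρ` and `(Vᴴ)_{:,J}` has
rank `ρ`. With `C = U Σ (Vᴴ)_{:,J}`, `R = U_{I,:} Σ Vᴴ`, `G = U_{I,:} Σ (Vᴴ)_{:,J}`, and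
`N = G⁺`, one has `M = C N R`. -/
theorem svd_to_cur {m n ρ k l : ℕ} (hk : ρ ≤ k) (hl : ρ ≤ l)
    (M : Matrix (Fin m) (Fin n) ℂ) (hrank : M.rank = ρ)
    (U : Matrix (Fin m) (Fin ρ) ℂ) (d : Fin ρ → ℂ) (V : Matrix (Fin n) (Fin ρ) ℂ)
    (hU : Uᴴ * U = 1) (hV : Vᴴ * V = 1) (hd : ∀ i, d i ≠ 0)
    (hM : M = U * Matrix.diagonal d * Vᴴ)
    (ι : Fin k → Fin m) (hι : Function.Injective ι)
    (κ : Fin l → Fin n) (hκ : Function.Injective κ)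
    (hUI : (U.submatrix ι id).rank = ρ)
    (hVJ : ((Vᴴ).submatrix id κ).rank = ρ)
    (N : Matrix (Fin l) (Fin k) ℂ)
    (hN : IsMPInv (U.submatrix ι id * Matrix.diagonal d * (Vᴴ).submatrix id κ) N) :
    M = (U * Matrix.diagonal d * (Vᴴ).submatrix id κ) * N *
      (U.submatrix ι id * Matrix.diagonal d * Vᴴ) := by
  obtain ⟨B, hB⟩ := cur_left_inv _ hUI
  obtain ⟨D, hD⟩ := cur_left_inv (((Vᴴ).submatrix id κ)ᴴ)
    (by rw [cur_rank, hVJ])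
  have hD' : (Vᴴ).submatrix id κ * Dᴴ = 1 := by
    have := congrArg Matrix.conjTranspose hD
    rwa [Matrix.conjTranspose_mul, Matrix.conjTranspose_conjTranspose,
      Matrix.conjTranspose_one] at this
  have h1 := hN.1
  generalize U.submatrix ι id = A at *
  generalize (Vᴴ).submatrix id κ = W at *
  generalize Matrix.diagonal d = S at *
  have key : S * W * N * (A * S) = S := by
    calc S * W * N * (A * S)
        = (B * A) * (S * W * N * (A * S)) * (W * Dᴴ) := by
          rw [hB, hD', Matrix.one_mul, Matrix.mul_one]
      _ = B * (A * S * W * N * (A * S * W)) * Dᴴ := by simp only [Matrix.mul_assoc]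
      _ = (B * A) * S * (W * Dᴴ) := by rw [h1]; simp only [Matrix.mul_assoc]
      _ = S := by rw [hB, hD', Matrix.one_mul, Matrix.mul_one]
  calc M = U * (S * W * N * (A * S)) * Vᴴ := by rw [key, hM]
    _ = _ := by simp only [Matrix.mul_assoc]
end
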